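/- For a traceless Hermitian operator ξ on ℂ^{d_A} ⊗ ℂ^{d_B}, Σ_{π,σ ∈ S₄} Tr((U_π^{A} ⊗ U_σ^{B}) ξ^{⊗4}) ≤ 153·(Tr(ξ²) + Tr(ξ_A²) + Tr(ξ_B²))², where U_π^A permutes the four A-factors according to π and U_σ^B permutes the four B-factors according to σ, and ξ_A = Tr_B ξ, ξ_B = Tr_A ξ. -/

import Mathlib

open ComplexOrder

/-- Partial trace over the `B` system. -/
noncomputable def ptraceB {dA dB : ℕ} (ξ : Matrix (Fin dA × Fin dB) (Fin dA × Fin dB) ℂ) :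
    Matrix (Fin dA) (Fin dA) ℂ :=
  fun i j => ∑ k, ξ (i, k) (j, k)

/-- Partial trace over the `A` system. -/
noncomputable def ptraceA {dA dB : ℕ} (ξ : Matrix (Fin dA × Fin dB) (Fin dA × Fin dB) ℂ) :
    Matrix (Fin dB) (Fin dB) ℂ :=
  fun i j => ∑ k, ξ (k, i) (k, j)

/-- `Tr((U_π^A ⊗ U_σ^B) ξ^{⊗4})`, written as an explicit index contraction:
the `A`-indices of the four copies of `ξ` are contracted according to `π` and the
`B`-indices according to `σ`. -/
noncomputable def permTrace4 {dA dB : ℕ}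
    (ξ : Matrix (Fin dA × Fin dB) (Fin dA × Fin dB) ℂ)
    (π σ : Equiv.Perm (Fin 4)) : ℂ :=
  ∑ a : Fin 4 → Fin dA, ∑ b : Fin 4 → Fin dB, ∏ i, ξ (a (π i), b (σ i)) (a i, b i)


def permSum {ι α R : Type*} [Fintype ι] [DecidableEq ι] [Fintype α] [CommSemiring R]
    (π : Equiv.Perm ι) (g : ι → α → α → R) : R :=
  ∑ a : ι → α, ∏ i, g i (a (π i)) (a i)

lemma permSum_equiv {ι κ α R : Type*} [Fintype ι] [DecidableEq ι] [Fintype κ] [DecidableEq κ]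
    [Fintype α] [CommSemiring R] (e : ι ≃ κ) (π : Equiv.Perm κ) (g : κ → α → α → R) :
    permSum π g = permSum (e.trans (π.trans e.symm)) (fun i => g (e i)) := by
  unfold permSum
  refine Fintype.sum_equiv (Equiv.arrowCongr e.symm (Equiv.refl α)) _ _ fun a => ?_
  refine Fintype.prod_equiv e.symm _ _ fun i => ?_
  simp

lemma sum_option_fun {ι α R : Type*} [Fintype ι] [DecidableEq ι] [Fintype α] [CommSemiring R]
    (F : (Option ι → α) → R) :
    ∑ a, F a = ∑ a : ι → α, ∑ t : α, F (fun o => o.elim t a) := by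
  rw [← Fintype.sum_prod_type']
  refine Fintype.sum_equiv (Equiv.piOptionEquivProd.trans (Equiv.prodComm _ _)) _ _ fun a => ?_
  congr 1
  funext o
  cases o <;> simp [Equiv.piOptionEquivProd]

lemma permSum_fix {ι α R : Type*} [Fintype ι] [DecidableEq ι] [Fintype α] [CommSemiring R]
    (π : Equiv.Perm (Option ι)) (g : Option ι → α → α → R) (h : π none = none) :
    permSum π g = (∑ t, g none t t) * permSum (Equiv.removeNone π) (fun i => g (some i)) := by
  unfold permSum
  rw [sum_option_fun, Finset.mul_sum]
  refine Finset.sum_congr rfl fun a _ => ?_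
  rw [Finset.sum_mul]
  refine Finset.sum_congr rfl fun t _ => ?_
  rw [Fintype.prod_option, h]
  simp only [Option.elim_none, Option.elim_some]
  congr 1
  refine Finset.prod_congr rfl fun i _ => ?_
  have : π (some i) ≠ none := fun h' => by
    have := π.injective (h'.trans h.symm); simp at this
  rw [← Equiv.removeNone_some π (Option.ne_none_iff_exists'.1 this)]
  simp

lemma permSum_step {ι α R : Type*} [Fintype ι] [DecidableEq ι] [Fintype α] [CommSemiring R]
    (π : Equiv.Perm (Option ι)) (g : Option ι → α → α → R) (i : ι) (h : π (some i) = none) :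
    permSum π g = permSum (Equiv.removeNone π)
      (Function.update (fun i => g (some i)) i
        (fun s t => ∑ u, g none s u * g (some i) u t)) := by
  unfold permSum
  rw [sum_option_fun]
  refine Finset.sum_congr rfl fun a _ => ?_
  rw [← Finset.mul_prod_erase Finset.univ _ (Finset.mem_univ i)]
  simp only [Function.update_self]
  rw [Finset.sum_mul]
  refine Finset.sum_congr rfl fun t _ => ?_
  rw [Fintype.prod_option, ← Finset.mul_prod_erase Finset.univ _ (Finset.mem_univ i), ← mul_assoc]
  rw [h, ← Equiv.removeNone_none π h]
  simp only [Option.elim_none, Option.elim_some]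
  congr 1
  refine Finset.prod_congr rfl fun j hj => ?_
  have hji := Finset.ne_of_mem_erase hj
  have : π (some j) ≠ none := fun h' => by
    have := π.injective (h'.trans h.symm); simp at this; exact hji this
  rw [← Equiv.removeNone_some π (Option.ne_none_iff_exists'.1 this)]
  simp [Function.update_of_ne hji]

lemma removeNone_ne {ι : Type*} (π : Equiv.Perm (Option ι)) (i j : ι) (h : π (some i) = none)
    (hji : j ≠ i) : some (Equiv.removeNone π j) = π (some j) := by
  apply Equiv.removeNone_some π
  apply Option.ne_none_iff_exists'.1
  intro h'
  have := π.injective (h'.trans h.symm); simp at this; exact hji this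

lemma removeNone_fix {ι : Type*} (π : Equiv.Perm (Option ι)) (j : ι) (h : π none = none) :
    some (Equiv.removeNone π j) = π (some j) := by
  apply Equiv.removeNone_some π
  apply Option.ne_none_iff_exists'.1
  intro h'
  have := π.injective (h'.trans h.symm); simp at this

/-- Tensors sitting at fixed points may be replaced by any tensor of the same trace. -/
lemma permSum_replace (α R : Type) [Fintype α] [CommSemiring R] (ι : Type) [Fintype ι] :
    ∀ [DecidableEq ι] (π : Equiv.Perm ι) (g g' : ι → α → α → R),
      (∀ i, g i = g' i ∨ (π i = i ∧ ∑ t, g i t t = ∑ t, g' i t t)) →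
      permSum π g = permSum π g' := by
  refine Fintype.induction_empty_option (P := fun ι _ => ∀ [DecidableEq ι] (π : Equiv.Perm ι)
    (g g' : ι → α → α → R), (∀ i, g i = g' i ∨ (π i = i ∧ ∑ t, g i t t = ∑ t, g' i t t)) →
      permSum π g = permSum π g') ?_ ?_ ?_ ι
  · intro ι κ _ e ih _ π g g' H
    classical
    let _ := Fintype.ofEquiv κ e.symm
    rw [permSum_equiv e, permSum_equiv e]
    refine ih _ _ _ fun i => ?_
    rcases H (e i) with h | ⟨h, h'⟩
    · exact Or.inl h
    · exact Or.inr ⟨by simp [h], h'⟩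
  · intro _ π g g' H
    simp [permSum]
  · intro ι _ ih inst π g g' H
    classical
    have : inst = (fun a b => Option.instDecidableEq a b) := Subsingleton.elim _ _
    subst this
    by_cases h : π none = none
    · rw [permSum_fix π g h, permSum_fix π g' h]
      congr 1
      · rcases H none with h | h
        · rw [h]
        · exact h.2
      · refine ih _ _ _ fun i => ?_
        rcases H (some i) with h1 | ⟨h1, h2⟩
        · exact Or.inl h1
        · right
          refine ⟨?_, h2⟩
          have := removeNone_fix π i h
          rw [h1] at this
          simpa using this
    · obtain ⟨o, ho⟩ := π.surjective none
      cases o with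
      | none => exact absurd ho h
      | some i =>
        rw [permSum_step π g i ho, permSum_step π g' i ho]
        refine ih _ _ _ fun j => ?_
        by_cases hji : j = i
        · subst hji
          left
          have h1 : g none = g' none := (H none).resolve_right fun h' => h h'.1
          have h2 : g (some j) = g' (some j) := (H (some j)).resolve_right fun h' => by
            rw [ho] at h'; simp at h'
          simp [h1, h2]
        · simp only [Function.update_of_ne hji]
          rcases H (some j) with h1 | ⟨h1, h2⟩
          · exact Or.inl h1
          · right
            refine ⟨?_, h2⟩
            have := removeNone_ne π i j ho hji
            rw [h1] at this
            simpa using this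

lemma frob_mul {α : Type} [Fintype α] (f g : α → α → ℝ) (M N : ℝ) 
    (hf : ∑ s, ∑ t, f s t ^ 2 ≤ M ^ 2) (hg : ∑ s, ∑ t, g s t ^ 2 ≤ N ^ 2) :
    ∑ s, ∑ t, (∑ u, f s u * g u t) ^ 2 ≤ (M * N) ^ 2 := by
  calc _ ≤ ∑ s, ∑ t, (∑ u, f s u ^ 2) * (∑ u, g u t ^ 2) := 
        Finset.sum_le_sum fun s _ => Finset.sum_le_sum fun t _ => 
          Finset.sum_mul_sq_le_sq_mul_sq _ _ _
    _ = (∑ s, ∑ t, f s t ^ 2) * ∑ s, ∑ t, g s t ^ 2 := by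
        rw [Finset.sum_comm (f := fun s t => g s t ^ 2), Finset.sum_mul_sum]
    _ ≤ M ^ 2 * N ^ 2 := by
        apply mul_le_mul hf hg _ (sq_nonneg _)
        positivity
    _ = _ := by ring

lemma frob_tr {α : Type} [Fintype α] (f g : α → α → ℝ) (M N : ℝ) (hM : 0 ≤ M) (hN : 0 ≤ N)
    (hf : ∑ s, ∑ t, f s t ^ 2 ≤ M ^ 2) (hg : ∑ s, ∑ t, g s t ^ 2 ≤ N ^ 2) :
    ∑ s, (∑ u, f s u * g u s) ≤ M * N := by
  apply le_of_sq_le_sq _ (mul_nonneg hM hN)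
  calc _ ≤ (∑ p : α × α, f p.1 p.2 ^ 2) * (∑ p : α × α, g p.2 p.1 ^ 2) := by
        rw [← Fintype.sum_prod_type']
        exact Finset.sum_mul_sq_le_sq_mul_sq Finset.univ _ _
    _ = (∑ s, ∑ t, f s t ^ 2) * ∑ s, ∑ t, g s t ^ 2 := by
        rw [Fintype.sum_prod_type, Fintype.sum_prod_type_right]
    _ ≤ M ^ 2 * N ^ 2 := by
        apply mul_le_mul hf hg _ (sq_nonneg _)
        positivity
    _ = _ := by ring

/-- Closed-loop contractions are bounded by products of Frobenius norms. -/
lemma permSum_le (α : Type) [Fintype α] (ι : Type) [Fintype ι] :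
    ∀ [DecidableEq ι] (π : Equiv.Perm ι) (g : ι → α → α → ℝ) (M : ι → ℝ),
      (∀ i s t, 0 ≤ g i s t) → (∀ i, 0 ≤ M i) → (∀ i, ∑ s, ∑ t, g i s t ^ 2 ≤ M i ^ 2) →
      (∀ i, π i = i → ∑ t, g i t t ≤ M i) →
      permSum π g ≤ ∏ i, M i := by
  refine Fintype.induction_empty_option (P := fun ι _ => ∀ [DecidableEq ι] (π : Equiv.Perm ι)
    (g : ι → α → α → ℝ) (M : ι → ℝ),
      (∀ i s t, 0 ≤ g i s t) → (∀ i, 0 ≤ M i) → (∀ i, ∑ s, ∑ t, g i s t ^ 2 ≤ M i ^ 2) →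
      (∀ i, π i = i → ∑ t, g i t t ≤ M i) →
      permSum π g ≤ ∏ i, M i) ?_ ?_ ?_ ι
  · intro ι κ _ e ih _ π g M h0 hM hF hT
    classical
    let _ := Fintype.ofEquiv κ e.symm
    rw [permSum_equiv e, ← Equiv.prod_comp e]
    exact ih _ _ (fun i => M (e i)) (fun i => h0 _) (fun i => hM _) (fun i => hF _)
      fun i hi => hT _ (by simpa [Equiv.symm_apply_eq] using hi)
  · intro _ π g M h0 hM hF hT
    simp [permSum]
  · intro ι _ ih inst π g M h0 hM hF hT
    classical
    have : inst = (fun a b => Option.instDecidableEq a b) := Subsingleton.elim _ _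
    subst this
    rw [Fintype.prod_option]
    by_cases h : π none = none
    · rw [permSum_fix π g h]
      refine mul_le_mul (hT _ h) ?_ ?_ (hM _)
      · refine ih _ _ _ (fun i => h0 _) (fun i => hM _) (fun i => hF _) fun i hi => hT _ ?_
        rw [← removeNone_fix π i h, hi]
      · exact Finset.sum_nonneg fun a _ => Finset.prod_nonneg fun i _ => h0 _ _ _
    · obtain ⟨o, ho⟩ := π.surjective none
      cases o with
      | none => exact absurd ho h
      | some i =>
        rw [permSum_step π g i ho]
        have hprod : M none * ∏ j, M (some j) = 
            ∏ j, Function.update (fun j => M (some j)) i (M none * M (some i)) j := by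
          rw [← Finset.mul_prod_erase Finset.univ _ (Finset.mem_univ i),
            ← Finset.mul_prod_erase Finset.univ _ (Finset.mem_univ i), ← mul_assoc]
          simp only [Function.update_self]
          congr 1
          refine Finset.prod_congr rfl fun j hj => ?_
          rw [Function.update_of_ne (Finset.ne_of_mem_erase hj)]
        rw [hprod]
        refine ih _ _ _ (fun j => ?_) (fun j => ?_) (fun j => ?_) (fun j hj => ?_) <;>
        by_cases hji : j = i
        · subst hji
          intro s t
          simp only [Function.update_self]
          exact Finset.sum_nonneg fun u _ => mul_nonneg (h0 _ _ _) (h0 _ _ _)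
        · simp only [Function.update_of_ne hji]; exact h0 _
        · subst hji
          simp only [Function.update_self]
          exact mul_nonneg (hM _) (hM _)
        · simp only [Function.update_of_ne hji]; exact hM _
        · subst hji
          simp only [Function.update_self]
          exact frob_mul _ _ _ _ (hF _) (hF _)
        · simp only [Function.update_of_ne hji]; exact hF _
        · subst hji
          simp only [Function.update_self]
          exact frob_tr _ _ _ _ (hM _) (hM _) (hF _) (hF _)
        · simp only [Function.update_of_ne hji]
          refine hT _ ?_
          rw [← removeNone_ne π i j ho hji, hj]

def keyP (p : Equiv.Perm (Fin 4) × Equiv.Perm (Fin 4)) : ℕ × ℕ × ℕ × ℕ :=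
  ((Finset.univ.filter fun i => p.1 i ≠ i ∧ p.2 i ≠ i).card,
   (Finset.univ.filter fun i => p.1 i ≠ i ∧ p.2 i = i).card,
   (Finset.univ.filter fun i => p.1 i = i ∧ p.2 i ≠ i).card,
   (Finset.univ.filter fun i => p.1 i = i ∧ p.2 i = i).card)

lemma key_count : ∀ q ∈ ([((4,0,0,0),81), ((3,1,0,0),72), ((3,0,1,0),72), ((2,2,0,0),54), 
   ((2,0,2,0),54), ((0,4,0,0),9), ((0,0,4,0),9), ((2,1,1,0),48), ((1,2,1,0),24), ((1,1,2,0),24),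
   ((0,2,2,0),6)] : List ((ℕ × ℕ × ℕ × ℕ) × ℕ)), 
   (Finset.univ.filter fun p => keyP p = q.1).card = q.2 := by
  decide +kernel

lemma key_mem : ∀ p, 0 < (keyP p).2.2.2 ∨ keyP p ∈ ({(4,0,0,0), (3,1,0,0), (3,0,1,0), (2,2,0,0), 
   (2,0,2,0), (0,4,0,0), (0,0,4,0), (2,1,1,0), (1,2,1,0), (1,1,2,0),
   (0,2,2,0)} : Finset (ℕ × ℕ × ℕ × ℕ)) := by
  decide +kernel

/-- Frobenius norm. -/
noncomputable def frobN {dA dB : ℕ} (m : Matrix (Fin dA × Fin dB) (Fin dA × Fin dB) ℂ) : ℝ :=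
  √(∑ p, ∑ q, ‖m p q‖ ^ 2)

lemma tr_le_of_supp {α : Type} [Fintype α] (g : α → α → ℝ) (t0 : α) (h0 : ∀ s t, 0 ≤ g s t)
    (h : ∀ s t, ¬ (s = t0 ∧ t = t0) → g s t = 0) :
    ∑ t, g t t ≤ √(∑ s, ∑ t, g s t ^ 2) := by
  have h1 : ∑ t, g t t = g t0 t0 :=
    Finset.sum_eq_single t0 (fun t _ ht => h t t fun h' => ht h'.1) (by simp)
  rw [h1]
  apply Real.le_sqrt_of_sq_le
  calc g t0 t0 ^ 2 ≤ ∑ t, g t0 t ^ 2 :=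
        Finset.single_le_sum (f := fun t => g t0 t ^ 2) (fun t _ => sq_nonneg _)
          (Finset.mem_univ t0)
    _ ≤ _ := Finset.single_le_sum (f := fun s => ∑ t, g s t ^ 2)
          (fun t _ => Finset.sum_nonneg fun _ _ => sq_nonneg _) (Finset.mem_univ t0)

lemma network_bound {dA dB : ℕ} (π σ : Equiv.Perm (Fin 4))
    (ζ : Fin 4 → Matrix (Fin dA × Fin dB) (Fin dA × Fin dB) ℂ) (a0 : Fin dA) (b0 : Fin dB)
    (hπ : ∀ i, π i = i → ∀ p q, ¬ (p.1 = a0 ∧ q.1 = a0) → ζ i p q = 0)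
    (hσ : ∀ i, σ i = i → ∀ p q, ¬ (p.2 = b0 ∧ q.2 = b0) → ζ i p q = 0) :
    ‖∑ a : Fin 4 → Fin dA, ∑ b : Fin 4 → Fin dB,
      ∏ i, ζ i (a (π i), b (σ i)) (a i, b i)‖ ≤ ∏ i, frobN (ζ i) := by
  let h : Fin 4 → Fin dB → Fin dB → ℝ := fun i b' b => √(∑ s, ∑ t, ‖ζ i (s, b') (t, b)‖ ^ 2)
  have hsq : ∀ i b' b, h i b' b ^ 2 = ∑ s, ∑ t, ‖ζ i (s, b') (t, b)‖ ^ 2 := fun i b' b =>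
    Real.sq_sqrt (by positivity)
  calc _ ≤ ∑ a : Fin 4 → Fin dA, ∑ b : Fin 4 → Fin dB,
          ∏ i, ‖ζ i (a (π i), b (σ i)) (a i, b i)‖ := by
        refine (norm_sum_le _ _).trans (Finset.sum_le_sum fun a _ => ?_)
        refine (norm_sum_le _ _).trans (Finset.sum_le_sum fun b _ => ?_)
        rw [norm_prod]
    _ = ∑ b : Fin 4 → Fin dB, permSum π (fun i s t => ‖ζ i (s, b (σ i)) (t, b i)‖) :=
        Finset.sum_comm
    _ ≤ ∑ b : Fin 4 → Fin dB, ∏ i, h i (b (σ i)) (b i) := by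
        refine Finset.sum_le_sum fun b _ => ?_
        refine permSum_le _ _ π _ _ (fun i s t => norm_nonneg _) (fun i => Real.sqrt_nonneg _)
          (fun i => (hsq _ _ _).ge) fun i hi => ?_
        refine tr_le_of_supp (fun s t => ‖ζ i (s, b (σ i)) (t, b i)‖) a0 (fun _ _ => norm_nonneg _)
          fun s t hst => ?_
        rw [hπ i hi _ _ hst, norm_zero]
    _ = permSum σ h := rfl
    _ ≤ _ := by
        have hfr : ∀ i, frobN (ζ i) = √(∑ s, ∑ t, h i s t ^ 2) := fun i => by
          unfold frobN
          congr 1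
          simp only [hsq, Fintype.sum_prod_type_right]
          refine Finset.sum_congr rfl fun b _ => ?_
          rw [Finset.sum_comm]
        refine permSum_le _ _ σ _ _ (fun i s t => Real.sqrt_nonneg _) (fun i => Real.sqrt_nonneg _)
          (fun i => ?_) fun i hi => ?_
        · rw [hfr, Real.sq_sqrt (by positivity)]
        · rw [hfr]
          refine tr_le_of_supp (h i) b0 (fun _ _ => Real.sqrt_nonneg _) fun s t hst => ?_
          have : ∀ x y, ζ i (x, s) (y, t) = 0 := fun x y => hσ i hi _ _ hst
          simp [h, this]

/-- First replacement. -/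
noncomputable def etaT {dA dB : ℕ} (ξ : Matrix (Fin dA × Fin dB) (Fin dA × Fin dB) ℂ)
    (b0 : Fin dB) (σ : Equiv.Perm (Fin 4)) (i : Fin 4) :
    Matrix (Fin dA × Fin dB) (Fin dA × Fin dB) ℂ := fun p q =>
  if σ i = i then (if p.2 = b0 ∧ q.2 = b0 then ptraceB ξ p.1 q.1 else 0) else ξ p q

/-- Second replacement. -/
noncomputable def zetaT {dA dB : ℕ} (ξ : Matrix (Fin dA × Fin dB) (Fin dA × Fin dB) ℂ)
    (a0 : Fin dA) (b0 : Fin dB) (π σ : Equiv.Perm (Fin 4)) (i : Fin 4) :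
    Matrix (Fin dA × Fin dB) (Fin dA × Fin dB) ℂ := fun p q =>
  if π i = i then (if p.1 = a0 ∧ q.1 = a0 then ptraceA (etaT ξ b0 σ i) p.2 q.2 else 0)
  else etaT ξ b0 σ i p q

lemma sum_delta {α : Type} [Fintype α] [DecidableEq α] (t0 : α) (c : ℂ) :
    ∑ t, (if t = t0 ∧ t = t0 then c else 0) = c := by
  simp

lemma permTrace4_eq {dA dB : ℕ} (ξ : Matrix (Fin dA × Fin dB) (Fin dA × Fin dB) ℂ)
    (a0 : Fin dA) (b0 : Fin dB) (π σ : Equiv.Perm (Fin 4)) :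
    permTrace4 ξ π σ = ∑ a : Fin 4 → Fin dA, ∑ b : Fin 4 → Fin dB,
      ∏ i, zetaT ξ a0 b0 π σ i (a (π i), b (σ i)) (a i, b i) := by
  calc permTrace4 ξ π σ = ∑ a : Fin 4 → Fin dA,
        permSum σ (fun i s t => ξ (a (π i), s) (a i, t)) := rfl
    _ = ∑ a : Fin 4 → Fin dA, permSum σ (fun i s t => etaT ξ b0 σ i (a (π i), s) (a i, t)) := by
        refine Finset.sum_congr rfl fun a _ => permSum_replace _ _ _ _ _ _ fun i => ?_
        by_cases h : σ i = i
        · right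
          refine ⟨h, ?_⟩
          simp [etaT, h, ptraceB]
        · left
          simp [etaT, h]
    _ = ∑ b : Fin 4 → Fin dB, permSum π (fun i s t => etaT ξ b0 σ i (s, b (σ i)) (t, b i)) :=
        Finset.sum_comm
    _ = ∑ b : Fin 4 → Fin dB,
        permSum π (fun i s t => zetaT ξ a0 b0 π σ i (s, b (σ i)) (t, b i)) := by
        refine Finset.sum_congr rfl fun a _ => permSum_replace _ _ _ _ _ _ fun i => ?_
        by_cases h : π i = i
        · right
          refine ⟨h, ?_⟩
          simp [zetaT, h, ptraceA]
        · left
          simp [zetaT, h]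
    _ = _ := Finset.sum_comm

/-- Frobenius norm, general. -/
noncomputable def frobG {α : Type} [Fintype α] (m : Matrix α α ℂ) : ℝ :=
  √(∑ p, ∑ q, ‖m p q‖ ^ 2)

lemma frobN_zeta {dA dB : ℕ} (ξ : Matrix (Fin dA × Fin dB) (Fin dA × Fin dB) ℂ)
    (hξ0 : ξ.trace = 0) (a0 : Fin dA) (b0 : Fin dB) (π σ : Equiv.Perm (Fin 4)) (i : Fin 4) :
    frobN (zetaT ξ a0 b0 π σ i) =
      if π i = i then (if σ i = i then 0 else frobG (ptraceA ξ))
      else (if σ i = i then frobG (ptraceB ξ) else frobG ξ) := by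
  by_cases h1 : π i = i <;> by_cases h2 : σ i = i
  · have : ∀ s t, ptraceA (etaT ξ b0 σ i) s t = 0 := by
      intro s t
      by_cases hst : s = b0 ∧ t = b0
      · simp only [ptraceA, etaT, h2, hst, ptraceB, if_true, and_self]
        rw [← Fintype.sum_prod_type']
        exact hξ0
      · simp [ptraceA, etaT, h2, hst]
    simp [frobN, zetaT, h1, h2, this]
  · have : ∀ s t, ptraceA (etaT ξ b0 σ i) s t = ptraceA ξ s t := by
      intro s t
      simp [ptraceA, etaT, h2]
    simp [frobN, frobG, zetaT, h1, h2, this, Fintype.sum_prod_type, apply_ite, ite_and]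
  · simp [frobN, frobG, zetaT, etaT, h1, h2, Fintype.sum_prod_type, apply_ite, ite_and]
  · simp [frobN, frobG, zetaT, etaT, h1, h2]

lemma permTrace4_bound {dA dB : ℕ} (ξ : Matrix (Fin dA × Fin dB) (Fin dA × Fin dB) ℂ)
    (hξ0 : ξ.trace = 0) (π σ : Equiv.Perm (Fin 4)) :
    ‖permTrace4 ξ π σ‖ ≤ ∏ i, if π i = i then (if σ i = i then 0 else frobG (ptraceA ξ))
      else (if σ i = i then frobG (ptraceB ξ) else frobG ξ) := by
  rcases isEmpty_or_nonempty (Fin dA) with hA | ⟨⟨a0⟩⟩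
  · simp only [permTrace4, Finset.univ_eq_empty, Finset.sum_empty, norm_zero]
    refine Finset.prod_nonneg fun i _ => ?_
    split_ifs <;> first | exact le_rfl | exact Real.sqrt_nonneg _
  rcases isEmpty_or_nonempty (Fin dB) with hB | ⟨⟨b0⟩⟩
  · simp only [permTrace4, Finset.univ_eq_empty, Finset.sum_empty, norm_zero, Finset.sum_const_zero]
    refine Finset.prod_nonneg fun i _ => ?_
    split_ifs <;> first | exact le_rfl | exact Real.sqrt_nonneg _
  rw [permTrace4_eq ξ a0 b0]
  refine (network_bound π σ _ a0 b0 ?_ ?_).trans_eq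
    (Finset.prod_congr rfl fun i _ => frobN_zeta ξ hξ0 a0 b0 π σ i)
  · intro i hi p q h
    simp [zetaT, hi, h]
  · intro i hi p q h
    simp [zetaT, etaT, hi, h, ptraceA]

lemma poly_bound (x y z : ℝ) :
    81 * x ^ 4 + 72 * x ^ 3 * (y + z) + 54 * x ^ 2 * (y ^ 2 + z ^ 2) + 9 * (y ^ 4 + z ^ 4)
      + 48 * x ^ 2 * y * z + 24 * x * y * z * (y + z) + 6 * y ^ 2 * z ^ 2
      ≤ 153 * (x ^ 2 + y ^ 2 + z ^ 2) ^ 2 := by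
  nlinarith [mul_nonneg (sq_nonneg x) (sq_nonneg (x - y)), mul_nonneg (sq_nonneg x) (sq_nonneg (x - z)),
    mul_nonneg (sq_nonneg x) (sq_nonneg (y - z)), mul_nonneg (sq_nonneg y) (sq_nonneg (x - z)),
    mul_nonneg (sq_nonneg z) (sq_nonneg (x - y)), mul_nonneg (sq_nonneg x) (sq_nonneg y),
    mul_nonneg (sq_nonneg x) (sq_nonneg z), mul_nonneg (sq_nonneg y) (sq_nonneg z),
    sq_nonneg (y ^ 2), sq_nonneg (z ^ 2)]

lemma count_bound (x y z : ℝ) :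
    ∑ π : Equiv.Perm (Fin 4), ∑ σ : Equiv.Perm (Fin 4),
      (∏ i, if π i = i then (if σ i = i then 0 else z) else (if σ i = i then y else x))
      ≤ 153 * (x ^ 2 + y ^ 2 + z ^ 2) ^ 2 := by
  let G : ℕ × ℕ × ℕ × ℕ → ℝ := fun k => x ^ k.1 * y ^ k.2.1 * z ^ k.2.2.1 * 0 ^ k.2.2.2
  let T : Finset (ℕ × ℕ × ℕ × ℕ) := {(4,0,0,0), (3,1,0,0), (3,0,1,0), (2,2,0,0),
   (2,0,2,0), (0,4,0,0), (0,0,4,0), (2,1,1,0), (1,2,1,0), (1,1,2,0), (0,2,2,0)}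
  have h1 : ∀ p : Equiv.Perm (Fin 4) × Equiv.Perm (Fin 4),
      (∏ i, if p.1 i = i then (if p.2 i = i then 0 else z) else (if p.2 i = i then y else x))
      = G (keyP p) := by
    intro p
    simp only [G, keyP, ← Finset.prod_const, Finset.prod_filter, ← Finset.prod_mul_distrib]
    refine Finset.prod_congr rfl fun i _ => ?_
    by_cases h1 : p.1 i = i <;> by_cases h2 : p.2 i = i <;> simp [h1, h2]
  have h2 : ∀ p, G (keyP p) = ∑ k ∈ T, if keyP p = k then G k else 0 := by
    intro p
    rw [Finset.sum_ite_eq]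
    split_ifs with h
    · rfl
    · have := (key_mem p).resolve_right h
      simp [G, this.ne']
  rw [← Fintype.sum_prod_type']
  simp only [h1, h2]
  rw [Finset.sum_comm]
  have h3 : ∀ k, ∑ p, (if keyP p = k then G k else 0)
      = (Finset.univ.filter fun p => keyP p = k).card * G k := by
    intro k
    rw [← Finset.sum_filter, Finset.sum_const, nsmul_eq_mul]
  have hc := key_count
  simp only [List.forall_mem_cons, List.not_mem_nil, false_imp_iff, implies_true, and_true] at hc
  obtain ⟨c1, c2, c3, c4, c5, c6, c7, c8, c9, c10, c11⟩ := hc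
  simp only [h3]
  simp only [T]
  repeat rw [Finset.sum_insert (by decide)]
  rw [Finset.sum_singleton, c1, c2, c3, c4, c5, c6, c7, c8, c9, c10, c11]
  simp only [G, pow_zero, pow_one, mul_one, one_mul]
  push_cast
  refine le_trans (le_of_eq ?_) (poly_bound x y z)
  ring

lemma trace_sq {α : Type} [Fintype α] (m : Matrix α α ℂ) (hm : m.IsHermitian) :
    (m * m).trace = ((frobG m ^ 2 : ℝ) : ℂ) := by
  rw [frobG, Real.sq_sqrt (by positivity)]
  simp only [Matrix.trace, Matrix.diag, Matrix.mul_apply]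
  push_cast
  refine Finset.sum_congr rfl fun i _ => Finset.sum_congr rfl fun j _ => ?_
  rw [← hm.apply j i, ← Complex.mul_conj']
  rfl

lemma permTrace4_conj {dA dB : ℕ} (ξ : Matrix (Fin dA × Fin dB) (Fin dA × Fin dB) ℂ)
    (hξ : ξ.IsHermitian) (π σ : Equiv.Perm (Fin 4)) :
    (starRingEnd ℂ) (permTrace4 ξ π σ) = permTrace4 ξ π⁻¹ σ⁻¹ := by
  unfold permTrace4
  rw [map_sum]
  refine Fintype.sum_equiv (Equiv.arrowCongr π.symm (Equiv.refl _)) _ _ fun a => ?_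
  rw [map_sum]
  refine Fintype.sum_equiv (Equiv.arrowCongr σ.symm (Equiv.refl _)) _ _ fun b => ?_
  rw [map_prod]
  refine Finset.prod_congr rfl fun i _ => ?_
  have := hξ.apply (a i, b i) (a (π i), b (σ i))
  simpa using this

/-- For a traceless Hermitian `ξ` on `ℂ^{d_A} ⊗ ℂ^{d_B}`,
`Σ_{π,σ ∈ S₄} Tr((U_π^A ⊗ U_σ^B) ξ^{⊗4}) ≤ 153 (Tr ξ² + Tr ξ_A² + Tr ξ_B²)²`. -/
theorem fourth_moment_diagram_bound {dA dB : ℕ}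
    (ξ : Matrix (Fin dA × Fin dB) (Fin dA × Fin dB) ℂ)
    (hξ : ξ.IsHermitian) (hξ0 : ξ.trace = 0) :
    ∑ π : Equiv.Perm (Fin 4), ∑ σ : Equiv.Perm (Fin 4), permTrace4 ξ π σ
      ≤ 153 * ((ξ * ξ).trace
          + (ptraceB ξ * ptraceB ξ).trace + (ptraceA ξ * ptraceA ξ).trace) ^ 2 := by
  have hreal : (starRingEnd ℂ) (∑ π : Equiv.Perm (Fin 4), ∑ σ : Equiv.Perm (Fin 4),
      permTrace4 ξ π σ) = ∑ π : Equiv.Perm (Fin 4), ∑ σ : Equiv.Perm (Fin 4),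
      permTrace4 ξ π σ := by
    rw [map_sum]
    refine Fintype.sum_equiv (Equiv.inv _) _ _ fun π => ?_
    rw [map_sum]
    refine Fintype.sum_equiv (Equiv.inv _) _ _ fun σ => ?_
    exact permTrace4_conj ξ hξ π σ
  have hA : (ptraceA ξ).IsHermitian := by
    ext i j
    simp only [ptraceA, Matrix.conjTranspose_apply, star_sum]
    exact Finset.sum_congr rfl fun k _ => hξ.apply _ _
  have hB : (ptraceB ξ).IsHermitian := by
    ext i j
    simp only [ptraceB, Matrix.conjTranspose_apply, star_sum]
    exact Finset.sum_congr rfl fun k _ => hξ.apply _ _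
  rw [trace_sq ξ hξ, trace_sq _ hA, trace_sq _ hB]
  obtain ⟨r, hr⟩ := Complex.conj_eq_iff_real.1 hreal
  have hle : r ≤ 153 * (frobG ξ ^ 2 + frobG (ptraceB ξ) ^ 2 + frobG (ptraceA ξ) ^ 2) ^ 2 := by
    refine le_trans ?_ (count_bound _ _ _)
    calc r ≤ ‖(r : ℂ)‖ := by rw [Complex.norm_real]; exact le_abs_self r
      _ ≤ _ := by
        rw [← hr]
        refine (norm_sum_le _ _).trans (Finset.sum_le_sum fun π _ => ?_)
        refine (norm_sum_le _ _).trans (Finset.sum_le_sum fun σ _ => ?_)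
        exact permTrace4_bound ξ hξ0 π σ
  rw [hr]
  exact_mod_cast hle
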